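/- arXiv:2110.05050 — 6 statements merged into one kernel-verified Lean document; each statement's English description precedes it below -/
import Mathlib

section
/- Let (Ω, P) be a probability space, S a measurable space, X : Ω → S a measurable map with pushforward law ρ = X_*P, and Y : Ω → ℝ a random variable taking only the values 0 and 1. Let q, q̂ : S → ℝ be measurable functions with values in [0,1], and assume that the conditional expectation of Y given the σ-algebra generated by X equals q ∘ X almost surely. Then E[(q̂(X) − Y)²] ≥ ∫_S q(x)(1 − q(x)) dρ(x), with equality if and only if q̂ = q ρ-almost everywhere. -/
open MeasureTheory

theorem brier_score_optimal_forecast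
    {Ω S : Type*} [MeasurableSpace Ω] [MeasurableSpace S]
    (μ : Measure Ω) [IsProbabilityMeasure μ]
    (X : Ω → S) (hX : Measurable X)
    (Y : Ω → ℝ) (hYmeas : Measurable Y)
    (hYvals : ∀ ω, Y ω = 0 ∨ Y ω = 1)
    (q qhat : S → ℝ) (hqmeas : Measurable q) (hqhatmeas : Measurable qhat)
    (hqvals : ∀ x, q x ∈ Set.Icc (0 : ℝ) 1)
    (hqhatvals : ∀ x, qhat x ∈ Set.Icc (0 : ℝ) 1)
    (hcond : μ[Y | MeasurableSpace.comap X ‹MeasurableSpace S›] =ᵐ[μ] fun ω => q (X ω)) :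
    (∫ x, q x * (1 - q x) ∂(Measure.map X μ)) ≤ ∫ ω, (qhat (X ω) - Y ω) ^ 2 ∂μ ∧
      (∫ ω, (qhat (X ω) - Y ω) ^ 2 ∂μ = ∫ x, q x * (1 - q x) ∂(Measure.map X μ) ↔
        qhat =ᵐ[Measure.map X μ] q) := by
  have hm : MeasurableSpace.comap X ‹MeasurableSpace S› ≤ ‹MeasurableSpace Ω› := hX.comap_le
  have bdd : ∀ f : Ω → ℝ, Measurable f → (∀ ω, |f ω| ≤ 1) → Integrable f μ := by
    intro f hf hb
    exact Integrable.of_bound hf.aestronglyMeasurable 1 (Filter.Eventually.of_forall hb)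
  have hYi : Integrable Y μ := by
    refine bdd Y hYmeas fun ω => ?_
    rcases hYvals ω with h | h <;> simp [h]
  have hp1 : ∀ x, |1 - 2 * qhat x| ≤ 1 := fun x => by
    have := hqhatvals x
    rw [abs_le]; constructor <;> linarith [this.1, this.2]
  have hgm : Measurable fun x => 1 - 2 * qhat x := by fun_prop
  have hgYi : Integrable (fun ω => (1 - 2 * qhat (X ω)) * Y ω) μ := by
    refine bdd _ ((hgm.comp hX).mul hYmeas) fun ω => ?_
    rcases hYvals ω with h | h <;> simp [h, hp1]
  have hgqi : Integrable (fun ω => (1 - 2 * qhat (X ω)) * q (X ω)) μ := by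
    refine bdd _ ((hgm.comp hX).mul (hqmeas.comp hX)) fun ω => ?_
    have := hqvals (X ω)
    rw [abs_mul, abs_of_nonneg this.1]
    exact mul_le_one₀ (hp1 _) this.1 this.2
  have hp2i : Integrable (fun ω => qhat (X ω) ^ 2) μ := by
    refine bdd _ ((hqhatmeas.comp hX).pow_const 2) fun ω => ?_
    have := hqhatvals (X ω)
    rw [abs_of_nonneg (sq_nonneg _)]
    exact pow_le_one₀ this.1 this.2
  have hqqi : Integrable (fun ω => q (X ω) * (1 - q (X ω))) μ := by
    have hmm : Measurable fun x => q x * (1 - q x) := by fun_prop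
    refine bdd _ (hmm.comp hX) fun ω => ?_
    have := hqvals (X ω)
    rw [abs_le]; constructor <;> nlinarith [this.1, this.2]
  have hdm : Measurable fun x => (qhat x - q x) ^ 2 := by fun_prop
  have hdi : Integrable (fun ω => (qhat (X ω) - q (X ω)) ^ 2) μ := by
    refine bdd _ (hdm.comp hX) fun ω => ?_
    have h1 := hqvals (X ω)
    have h2 := hqhatvals (X ω)
    rw [abs_of_nonneg (sq_nonneg _), sq_le_one_iff_abs_le_one, abs_le]
    constructor <;> linarith [h1.1, h1.2, h2.1, h2.2]
  -- pull-out property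
  have hpull : ∫ ω, (1 - 2 * qhat (X ω)) * Y ω ∂μ
      = ∫ ω, (1 - 2 * qhat (X ω)) * q (X ω) ∂μ := by
    have hsm : StronglyMeasurable[MeasurableSpace.comap X ‹MeasurableSpace S›]
        (fun ω => 1 - 2 * qhat (X ω)) :=
      (hgm.comp (comap_measurable X)).stronglyMeasurable
    have h := condExp_mul_of_stronglyMeasurable_left (μ := μ) hsm hgYi hYi
    rw [← integral_condExp hm]
    refine integral_congr_ae ?_
    filter_upwards [h, hcond] with ω h1 h2
    have h3 := h1.trans (by rw [Pi.mul_apply, h2])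
    exact h3
  have key : ∫ ω, (qhat (X ω) - Y ω) ^ 2 ∂μ
      = ∫ ω, (qhat (X ω) - q (X ω)) ^ 2 ∂μ + ∫ x, q x * (1 - q x) ∂(Measure.map X μ) := by
    rw [integral_map hX.aemeasurable
      (by fun_prop : Measurable fun x => q x * (1 - q x)).aestronglyMeasurable]
    rw [← integral_add hdi hqqi]
    calc ∫ ω, (qhat (X ω) - Y ω) ^ 2 ∂μ
        = ∫ ω, (qhat (X ω) ^ 2 + (1 - 2 * qhat (X ω)) * Y ω) ∂μ := by
          congr 1; ext ω
          rcases hYvals ω with h | h <;> rw [h] <;> ring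
      _ = ∫ ω, (qhat (X ω) ^ 2 + (1 - 2 * qhat (X ω)) * q (X ω)) ∂μ := by
          rw [integral_add hp2i hgYi, integral_add hp2i hgqi, hpull]
      _ = _ := by
          congr 1; ext ω; ring
  rw [key]
  have hnn : 0 ≤ ∫ ω, (qhat (X ω) - q (X ω)) ^ 2 ∂μ :=
    integral_nonneg fun ω => sq_nonneg _
  refine ⟨by linarith, ?_⟩
  rw [add_eq_right, integral_eq_zero_iff_of_nonneg (fun ω => sq_nonneg _) hdi]
  have hset : MeasurableSet {x | qhat x = q x} := measurableSet_eq_fun hqhatmeas hqmeas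
  rw [Filter.EventuallyEq, Filter.EventuallyEq, ae_map_iff hX.aemeasurable hset]
  refine Filter.eventually_congr (Filter.Eventually.of_forall fun ω => ?_)
  simp [sub_eq_zero]
end

section
/- Let S be a nonempty finite type and let G be an irreducible row-stochastic real matrix indexed by S. Then the eigenspace {q : S → ℝ | G ·ᵥ q = q} of G for the eigenvalue 1 consists exactly of the constant vectors; in particular it is one-dimensional. -/
theorem irreducible_stochastic_eigenspace_one_constant
    {S : Type*} [Fintype S] [Nonempty S] [DecidableEq S] (G : Matrix S S ℝ)
    (hnonneg : ∀ i j, 0 ≤ G i j) (hrowsum : ∀ i, ∑ j, G i j = 1)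
    (hirr : ∀ i j, ∃ n : ℕ, 1 ≤ n ∧ 0 < (G ^ n) i j) :
    {q : S → ℝ | G.mulVec q = q} = {q : S → ℝ | ∃ c : ℝ, q = Function.const S c} ∧
      Module.finrank ℝ (Module.End.eigenspace (Matrix.toLin' G) 1) = 1 := by
  have hconst : ∀ c : ℝ, G.mulVec (Function.const S c) = Function.const S c := by
    intro c
    funext i
    simp only [Matrix.mulVec, dotProduct, Function.const_apply]
    rw [← Finset.sum_mul, hrowsum, one_mul]
  have hpn : ∀ (n : ℕ) i j, 0 ≤ (G ^ n) i j := by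
    intro n
    induction n with
    | zero =>
      intro i j
      rw [pow_zero, Matrix.one_apply]
      split_ifs <;> norm_num
    | succ n ih =>
      intro i j
      rw [pow_succ, Matrix.mul_apply]
      exact Finset.sum_nonneg fun k _ => mul_nonneg (ih i k) (hnonneg k j)
  have hpow : ∀ (q : S → ℝ), G.mulVec q = q → ∀ n : ℕ, (G ^ n).mulVec q = q := by
    intro q hq n
    induction n with
    | zero => simp
    | succ n ih => rw [pow_succ, ← Matrix.mulVec_mulVec, hq, ih]
  have key : ∀ q : S → ℝ, G.mulVec q = q → ∃ c : ℝ, q = Function.const S c := by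
    intro q hq
    obtain ⟨i, hi⟩ := Finite.exists_max q
    refine ⟨q i, funext fun j => ?_⟩
    obtain ⟨n, -, hn⟩ := hirr i j
    have hr : G.mulVec (Function.const S (q i) - q) = Function.const S (q i) - q := by
      rw [Matrix.mulVec_sub, hconst, hq]
    have h := congrFun (hpow _ hr n) i
    simp only [Matrix.mulVec, dotProduct, Pi.sub_apply, Function.const_apply, sub_self] at h
    rw [Finset.sum_eq_zero_iff_of_nonneg
      (fun k _ => mul_nonneg (hpn n i k) (sub_nonneg.2 (hi k)))] at h
    have hj := h j (Finset.mem_univ j)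
    rcases mul_eq_zero.1 hj with h0 | h0
    · exact absurd h0 hn.ne'
    · simp only [Function.const_apply]
      linarith
  refine ⟨?_, ?_⟩
  · ext q
    constructor
    · exact key q
    · rintro ⟨c, rfl⟩
      exact hconst c
  · refine finrank_eq_one (⟨Function.const S 1, ?_⟩ : Module.End.eigenspace (Matrix.toLin' G) 1) ?_ ?_
    · rw [Module.End.mem_eigenspace_iff, Matrix.toLin'_apply, one_smul]
      exact hconst 1
    · intro h
      have h1 := congrFun (congrArg Subtype.val h) (Classical.arbitrary S)
      simp at h1
    · rintro ⟨w, hw⟩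
      rw [Module.End.mem_eigenspace_iff, Matrix.toLin'_apply, one_smul] at hw
      obtain ⟨c, rfl⟩ := key w hw
      refine ⟨c, Subtype.ext (funext fun i => ?_)⟩
      simp
end

section
/- Let S be a finite type, let G̃ be a row-stochastic real matrix indexed by S, and let a ≠ b be two states such that row a of G̃ is the standard basis vector e_a (i.e. G̃ a j = δ_{a j} for all j) and row b of G̃ is e_b. Then the eigenspace {q : S → ℝ | G̃ ·ᵥ q = q} of G̃ for the eigenvalue 1 has dimension at least 2. -/
theorem absorbing_rows_eigenspace_dim_ge_two
    {S : Type*} [Fintype S] [DecidableEq S] (Gt : Matrix S S ℝ)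
    (hnonneg : ∀ i j, 0 ≤ Gt i j) (hrowsum : ∀ i, ∑ j, Gt i j = 1)
    (a b : S) (hab : a ≠ b)
    (ha : ∀ j, Gt a j = if j = a then 1 else 0)
    (hb : ∀ j, Gt b j = if j = b then 1 else 0) :
    2 ≤ Module.finrank ℝ (Module.End.eigenspace (Matrix.toLin' Gt) 1) := by
  let f : (S → ℝ) →ₗ[ℝ] (S → ℝ) := Matrix.toLin' Gt - algebraMap ℝ (Module.End ℝ (S → ℝ)) 1
  let P : (S → ℝ) →ₗ[ℝ] ℝ × ℝ := (LinearMap.proj a).prod (LinearMap.proj b)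
  have hP : Function.Surjective P := by
    rintro ⟨x, y⟩
    refine ⟨fun s => if s = a then x else y, ?_⟩
    simp [P, hab.symm]
  have hle : LinearMap.range f ≤ LinearMap.ker P := by
    rintro _ ⟨v, rfl⟩
    simp [P, f, Matrix.mulVec, dotProduct, ha, hb]
  have h1 := LinearMap.finrank_range_add_finrank_ker f
  have h2 := LinearMap.finrank_range_add_finrank_ker P
  have h3 := Submodule.finrank_mono hle
  have h4 : Module.finrank ℝ (LinearMap.range P) = 2 := by
    rw [LinearMap.range_eq_top.mpr hP, finrank_top]
    simp
  have h5 : Module.End.eigenspace (Matrix.toLin' Gt) 1 = LinearMap.ker f :=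
    Module.End.eigenspace_def
  rw [h5]
  omega
end

section
/- Let S be a finite type, let G be an irreducible row-stochastic real matrix indexed by S, and let a ≠ b be two states. Define G̃ by: G̃ a j = δ_{a j} and G̃ b j = δ_{b j} for all j (states a and b are made absorbing), and G̃ i j = G i j for every i ∉ {a,b}. Then the eigenspace {q : S → ℝ | G̃ ·ᵥ q = q} of G̃ for the eigenvalue 1 has dimension exactly 2. -/
theorem absorbing_max_principle {S : Type*} [Fintype S] [DecidableEq S] (G : Matrix S S ℝ)
    (hnonneg : ∀ i j, 0 ≤ G i j) (hrowsum : ∀ i, ∑ j, G i j = 1)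
    (hirr : ∀ i j, ∃ n : ℕ, 1 ≤ n ∧ 0 < (G ^ n) i j)
    (a b : S) (h : S → ℝ) (h_a : h a = 0) (h_b : h b = 0)
    (hh : ∀ i, i ≠ a → i ≠ b → h i = ∑ j, G i j * h j) (s : S) : h s ≤ 0 := by
  obtain ⟨m, -, hm⟩ := Finset.exists_max_image Finset.univ h ⟨a, Finset.mem_univ a⟩
  by_contra! hs
  have hpos : 0 < h m := lt_of_lt_of_le hs (hm s (Finset.mem_univ s))
  have closed : ∀ i j, h i = h m → h j ≠ h m → G i j = 0 := by
    intro i j hi hj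
    have hia : i ≠ a := by
      rintro rfl
      linarith
    have hib : i ≠ b := by
      rintro rfl
      linarith
    have h1 : ∑ k, G i k * (h m - h k) = 0 := by
      simp only [mul_sub, Finset.sum_sub_distrib, ← Finset.sum_mul, hrowsum, one_mul]
      rw [← hh i hia hib, hi, sub_self]
    have h2 := (Finset.sum_eq_zero_iff_of_nonneg (fun k _ =>
      mul_nonneg (hnonneg i k) (sub_nonneg.2 (hm k (Finset.mem_univ k))))).1 h1 j
        (Finset.mem_univ j)
    rcases mul_eq_zero.1 h2 with h3 | h3
    · exact h3
    · exact absurd (by linarith) hj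
  have hpow : ∀ n : ℕ, ∀ j, h j ≠ h m → (G ^ n) m j = 0 := by
    intro n
    induction n with
    | zero =>
      intro j hj
      have : m ≠ j := by
        rintro rfl
        exact hj rfl
      simp [this]
    | succ n ih =>
      intro j hj
      rw [pow_succ, Matrix.mul_apply]
      apply Finset.sum_eq_zero
      intro k _
      by_cases hk : h k = h m
      · rw [closed k j hk hj, mul_zero]
      · rw [ih k hk, zero_mul]
  obtain ⟨n, -, hn⟩ := hirr m a
  rw [hpow n a (by linarith)] at hn
  exact lt_irrefl _ hn

theorem absorbing_zero {S : Type*} [Fintype S] [DecidableEq S] (G : Matrix S S ℝ)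
    (hnonneg : ∀ i j, 0 ≤ G i j) (hrowsum : ∀ i, ∑ j, G i j = 1)
    (hirr : ∀ i j, ∃ n : ℕ, 1 ≤ n ∧ 0 < (G ^ n) i j)
    (a b : S) (h : S → ℝ) (h_a : h a = 0) (h_b : h b = 0)
    (hh : ∀ i, i ≠ a → i ≠ b → h i = ∑ j, G i j * h j) : h = 0 := by
  funext s
  have h1 := absorbing_max_principle G hnonneg hrowsum hirr a b h h_a h_b hh s
  have h2 := absorbing_max_principle G hnonneg hrowsum hirr a b (fun i => - h i)
    (by simp [h_a]) (by simp [h_b])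
    (by intro i hi hi'; simp [hh i hi hi']) s
  simp only [Pi.zero_apply]
  linarith

theorem absorbing_modification_eigenspace_dim_two
    {S : Type*} [Fintype S] [DecidableEq S] (G : Matrix S S ℝ)
    (hnonneg : ∀ i j, 0 ≤ G i j) (hrowsum : ∀ i, ∑ j, G i j = 1)
    (hirr : ∀ i j, ∃ n : ℕ, 1 ≤ n ∧ 0 < (G ^ n) i j)
    (a b : S) (hab : a ≠ b)
    (Gt : Matrix S S ℝ)
    (ha : ∀ j, Gt a j = if j = a then 1 else 0)
    (hb : ∀ j, Gt b j = if j = b then 1 else 0)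
    (hother : ∀ i, i ≠ a → i ≠ b → ∀ j, Gt i j = G i j) :
    Module.finrank ℝ (Module.End.eigenspace (Matrix.toLin' Gt) 1) = 2 := by
  have hmem : ∀ q : S → ℝ, q ∈ Module.End.eigenspace (Matrix.toLin' Gt) 1 ↔
      ∀ i, i ≠ a → i ≠ b → q i = ∑ j, G i j * q j := by
    intro q
    rw [Module.End.mem_eigenspace_iff, one_smul, Matrix.toLin'_apply]
    constructor
    · intro h i hi hi'
      have h1 := congrFun h i
      simp only [Matrix.mulVec, dotProduct, hother i hi hi'] at h1
      exact h1.symm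
    · intro h
      funext i
      simp only [Matrix.mulVec, dotProduct]
      by_cases hi : i = a
      · subst hi
        simp [ha]
      by_cases hi' : i = b
      · subst hi'
        simp [hb]
      simp only [hother i hi hi']
      exact (h i hi hi').symm
  let L : (S → ℝ) →ₗ[ℝ] (S → ℝ) :=
    { toFun := fun q i => if i = a ∨ i = b then q i else q i - ∑ j, G i j * q j
      map_add' := by
        intro x y
        funext i
        by_cases hi : i = a ∨ i = b
        · simp [hi]
        · simp only [hi, if_false, Pi.add_apply, mul_add, Finset.sum_add_distrib]
          ring
      map_smul' := by
        intro c x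
        funext i
        by_cases hi : i = a ∨ i = b
        · simp [hi]
        · simp only [hi, if_false, Pi.smul_apply, smul_eq_mul, RingHom.id_apply, mul_sub,
            Finset.mul_sum, mul_left_comm] }
  have hL : ∀ q i, L q i = if i = a ∨ i = b then q i else q i - ∑ j, G i j * q j :=
    fun _ _ => rfl
  have hinj : Function.Injective L := by
    rw [← LinearMap.ker_eq_bot, LinearMap.ker_eq_bot']
    intro q hq
    refine absorbing_zero G hnonneg hrowsum hirr a b q ?_ ?_ ?_
    · simpa [hL] using congrFun hq a
    · simpa [hL] using congrFun hq b
    · intro i hi hi'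
      have h1 := congrFun hq i
      rw [hL, if_neg (by tauto)] at h1
      simp only [Pi.zero_apply] at h1
      linarith
  have hsurj : Function.Surjective L := LinearMap.injective_iff_surjective.1 hinj
  let E := Module.End.eigenspace (Matrix.toLin' Gt) 1
  let φ : E →ₗ[ℝ] ℝ × ℝ :=
    (((LinearMap.proj a : (S → ℝ) →ₗ[ℝ] ℝ).prod (LinearMap.proj b)).comp E.subtype)
  have hφ : ∀ q : E, φ q = (q.1 a, q.1 b) := fun _ => rfl
  have hφb : Function.Bijective φ := by
    constructor
    · rw [← LinearMap.ker_eq_bot, LinearMap.ker_eq_bot']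
      rintro ⟨q, hq⟩ h
      rw [hφ, Prod.mk_eq_zero] at h
      apply Subtype.ext
      exact absorbing_zero G hnonneg hrowsum hirr a b q h.1 h.2 ((hmem q).1 hq)
    · rintro ⟨x, y⟩
      obtain ⟨q, hq⟩ := hsurj (fun i => if i = a then x else if i = b then y else 0)
      refine ⟨⟨q, (hmem q).2 ?_⟩, ?_⟩
      · intro i hi hi'
        have h1 := congrFun hq i
        rw [hL, if_neg (by tauto)] at h1
        simp only [hi, hi', if_false] at h1
        linarith
      · have h1 := congrFun hq a
        have h2 := congrFun hq b
        simp [hL] at h1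
        simp [hL, hab.symm] at h2
        exact Prod.ext h1 h2
  have hfin := (LinearEquiv.ofBijective φ hφb).finrank_eq
  rw [Module.finrank_prod, Module.finrank_self] at hfin
  exact hfin
end

section
/- Let S be a finite type, let G be an irreducible row-stochastic real matrix indexed by S, and let a ≠ b be two states. Define G̃ by: G̃ a j = δ_{a j} and G̃ b j = δ_{b j} for all j, and G̃ i j = G i j for every i ∉ {a,b}. Then there exists a unique vector q : S → ℝ satisfying G̃ ·ᵥ q = q together with the boundary conditions q a = 0 and q b = 1. -/
theorem committor_max_principle
    {S : Type*} [Fintype S] [DecidableEq S] (G : Matrix S S ℝ)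
    (hnonneg : ∀ i j, 0 ≤ G i j) (hrowsum : ∀ i, ∑ j, G i j = 1)
    (hirr : ∀ i j, ∃ n : ℕ, 1 ≤ n ∧ 0 < (G ^ n) i j)
    (a b : S) (q : S → ℝ) (qa : q a = 0) (qb : q b = 0)
    (hq : ∀ i, i ≠ a → i ≠ b → ∑ j, G i j * q j = q i) (i : S) : q i ≤ 0 := by
  haveI : Nonempty S := ⟨a⟩
  obtain ⟨m, hm⟩ := Finite.exists_max q
  by_contra hi
  have hpos : 0 < q m := lt_of_lt_of_le (not_le.mp hi) (hm i)
  have step : ∀ k j, q k = q m → 0 < G k j → q j = q m := by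
    intro k j hk hkj
    have hka : k ≠ a := by rintro rfl; linarith
    have hkb : k ≠ b := by rintro rfl; linarith
    have hsum : ∑ j, G k j * (q m - q j) = 0 := by
      simp only [mul_sub, Finset.sum_sub_distrib]
      rw [← Finset.sum_mul, hrowsum, hq k hka hkb, hk]; ring
    have h0 := (Finset.sum_eq_zero_iff_of_nonneg
      (fun j _ => mul_nonneg (hnonneg k j) (sub_nonneg.mpr (hm j)))).mp hsum j
      (Finset.mem_univ j)
    rcases mul_eq_zero.mp h0 with h | h <;> linarith
  have steps : ∀ n : ℕ, ∀ k j, q k = q m → 0 < (G ^ n) k j → q j = q m := by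
    intro n
    induction n with
    | zero =>
      intro k j hk h
      by_cases hkj : k = j
      · rw [← hkj, hk]
      · simp [Matrix.one_apply, hkj] at h
    | succ n ih =>
      intro k j hk h
      rw [pow_succ', Matrix.mul_apply] at h
      obtain ⟨l, -, hl⟩ := Finset.exists_lt_of_sum_lt
        (s := Finset.univ) (f := fun _ : S => (0 : ℝ))
        (g := fun l => G k l * (G ^ n) l j) (by simpa using h)
      have h1 : 0 < G k l := by
        rcases (hnonneg k l).lt_or_eq with h1 | h1
        · exact h1
        · simp [← h1] at hl
      exact ih l j (step k l hk h1) (pos_of_mul_pos_right hl h1.le)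
  obtain ⟨n, -, hn⟩ := hirr m a
  have := steps n m a rfl hn
  linarith

theorem committor_exists_unique
    {S : Type*} [Fintype S] [DecidableEq S] (G : Matrix S S ℝ)
    (hnonneg : ∀ i j, 0 ≤ G i j) (hrowsum : ∀ i, ∑ j, G i j = 1)
    (hirr : ∀ i j, ∃ n : ℕ, 1 ≤ n ∧ 0 < (G ^ n) i j)
    (a b : S) (hab : a ≠ b)
    (Gt : Matrix S S ℝ)
    (ha : ∀ j, Gt a j = if j = a then 1 else 0)
    (hb : ∀ j, Gt b j = if j = b then 1 else 0)
    (hother : ∀ i, i ≠ a → i ≠ b → ∀ j, Gt i j = G i j) :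
    ∃! q : S → ℝ, Gt.mulVec q = q ∧ q a = 0 ∧ q b = 1 := by
  let A : Matrix S S ℝ := fun i j =>
    if i = a ∨ i = b then (1 : Matrix S S ℝ) i j else (1 : Matrix S S ℝ) i j - G i j
  have hA1 : ∀ i, (i = a ∨ i = b) → ∀ q : S → ℝ, A.mulVec q i = q i := by
    intro i hi q
    simp [Matrix.mulVec, dotProduct, A, hi, Matrix.one_apply]
  have hA2 : ∀ i, i ≠ a → i ≠ b → ∀ q : S → ℝ,
      A.mulVec q i = q i - ∑ j, G i j * q j := by
    intro i h1 h2 q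
    simp [Matrix.mulVec, dotProduct, A, h1, h2, Matrix.one_apply, sub_mul,
      Finset.sum_sub_distrib]
  have hinj : Function.Injective (Matrix.mulVecLin A) := by
    rw [← LinearMap.ker_eq_bot, LinearMap.ker_eq_bot']
    intro q hq
    have hq' : ∀ i, A.mulVec q i = 0 := fun i => congrFun hq i
    have qa : q a = 0 := by rw [← hA1 a (Or.inl rfl) q, hq']
    have qb : q b = 0 := by rw [← hA1 b (Or.inr rfl) q, hq']
    have hh : ∀ i, i ≠ a → i ≠ b → ∑ j, G i j * q j = q i := by
      intro i h1 h2
      have := hA2 i h1 h2 q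
      rw [hq'] at this
      linarith
    funext i
    have h1 := committor_max_principle G hnonneg hrowsum hirr a b q qa qb hh i
    have h2 := committor_max_principle G hnonneg hrowsum hirr a b (fun i => - q i)
      (by simp [qa]) (by simp [qb])
      (fun i h1 h2 => by simp [Finset.sum_neg_distrib, hh i h1 h2]) i
    simp only [Pi.zero_apply]
    linarith
  have hsurj := LinearMap.surjective_of_injective hinj
  have key : ∀ q : S → ℝ, (Gt.mulVec q = q ∧ q a = 0 ∧ q b = 1) ↔
      Matrix.mulVecLin A q = Pi.single b 1 := by
    intro q
    have hG : ∀ i, i ≠ a → i ≠ b → Gt.mulVec q i = ∑ j, G i j * q j := by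
      intro i h1 h2
      simp [Matrix.mulVec, dotProduct, hother i h1 h2]
    have hGa : Gt.mulVec q a = q a := by simp [Matrix.mulVec, dotProduct, ha]
    have hGb : Gt.mulVec q b = q b := by simp [Matrix.mulVec, dotProduct, hb]
    constructor
    · rintro ⟨h, qa, qb⟩
      funext i
      rw [Matrix.mulVecLin_apply]
      by_cases h1 : i = a
      · subst h1; rw [hA1 i (Or.inl rfl), qa]; simp [hab]
      by_cases h2 : i = b
      · subst h2; rw [hA1 i (Or.inr rfl), qb]; simp
      rw [hA2 i h1 h2, ← hG i h1 h2, h]; simp [h2]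
    · intro h
      have h' : ∀ i, A.mulVec q i = (Pi.single b 1 : S → ℝ) i := fun i => congrFun h i
      refine ⟨?_, ?_, ?_⟩
      · funext i
        by_cases h1 : i = a
        · rw [h1, hGa]
        by_cases h2 : i = b
        · rw [h2, hGb]
        have := h' i
        rw [hA2 i h1 h2, ← hG i h1 h2, Pi.single_eq_of_ne h2] at this
        linarith
      · rw [← hA1 a (Or.inl rfl) q, h']; simp [hab]
      · rw [← hA1 b (Or.inr rfl) q, h']; simp
  obtain ⟨q, hq⟩ := hsurj (Pi.single b 1)
  refine ⟨q, (key q).mpr hq, fun p hp => hinj ?_⟩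
  rw [hq]
  exact (key p).mp hp
end

section
/- Let S be a finite type, let G be an irreducible row-stochastic real matrix indexed by S, and let a ≠ b be two states. Define G̃ by: G̃ a j = δ_{a j} and G̃ b j = δ_{b j} for all j, and G̃ i j = G i j for every i ∉ {a,b}. If q : S → ℝ satisfies G̃ ·ᵥ q = q, q a = 0, and q b = 1, then 0 ≤ q i ≤ 1 for every state i ∈ S. -/
theorem max_principle_aux {S : Type*} [Fintype S] [DecidableEq S] (G : Matrix S S ℝ)
    (hnonneg : ∀ i j, 0 ≤ G i j) (hrowsum : ∀ i, ∑ j, G i j = 1)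
    (hirr : ∀ i j, ∃ n : ℕ, 1 ≤ n ∧ 0 < (G ^ n) i j)
    (a b : S) (f : S → ℝ) (c : ℝ) (hfa : f a ≤ c) (hfb : f b ≤ c)
    (hf : ∀ i, i ≠ a → i ≠ b → ∑ j, G i j * f j = f i) : ∀ i, f i ≤ c := by
  by_contra! hcon
  obtain ⟨i0, hi0⟩ := hcon
  obtain ⟨m, -, hm⟩ := Finset.exists_max_image Finset.univ f ⟨i0, Finset.mem_univ i0⟩
  have hmc : c < f m := lt_of_lt_of_le hi0 (hm i0 (Finset.mem_univ _))
  have step : ∀ i j, f i = f m → 0 < G i j → f j = f m := by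
    intro i j hi hij
    have hia : i ≠ a := by rintro rfl; linarith
    have hib : i ≠ b := by rintro rfl; linarith
    have h0 : ∑ j, G i j * (f m - f j) = 0 := by
      simp only [mul_sub, Finset.sum_sub_distrib, ← Finset.sum_mul, hrowsum, hf i hia hib, hi]
      ring
    have h1 := (Finset.sum_eq_zero_iff_of_nonneg (fun k _ =>
      mul_nonneg (hnonneg i k) (sub_nonneg.2 (hm k (Finset.mem_univ _))))).1 h0 j
        (Finset.mem_univ _)
    rcases mul_eq_zero.1 h1 with h | h <;> linarith
  have reach : ∀ n : ℕ, ∀ j, 0 < (G ^ n) m j → f j = f m := by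
    intro n
    induction n with
    | zero =>
      intro j hj
      by_cases h : m = j
      · rw [h]
      · simp [Matrix.one_apply, h] at hj
    | succ n ih =>
      intro j hj
      rw [pow_succ, Matrix.mul_apply] at hj
      obtain ⟨k, -, hk⟩ := Finset.exists_lt_of_sum_lt (s := Finset.univ)
        (f := fun _ : S => (0 : ℝ)) (by simpa using hj)
      have h1 : 0 < (G ^ n) m k := pos_of_mul_pos_left hk (hnonneg k j)
      have h2 : 0 < G k j := pos_of_mul_pos_right hk h1.le
      exact step k j (ih k h1) h2
  obtain ⟨n, -, hn⟩ := hirr m a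
  have := reach n a hn
  linarith


theorem committor_maximum_principle
    {S : Type*} [Fintype S] [DecidableEq S] (G : Matrix S S ℝ)
    (hnonneg : ∀ i j, 0 ≤ G i j) (hrowsum : ∀ i, ∑ j, G i j = 1)
    (hirr : ∀ i j, ∃ n : ℕ, 1 ≤ n ∧ 0 < (G ^ n) i j)
    (a b : S) (hab : a ≠ b)
    (Gt : Matrix S S ℝ)
    (ha : ∀ j, Gt a j = if j = a then 1 else 0)
    (hb : ∀ j, Gt b j = if j = b then 1 else 0)
    (hother : ∀ i, i ≠ a → i ≠ b → ∀ j, Gt i j = G i j)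
    (q : S → ℝ) (hq : Gt.mulVec q = q) (hqa : q a = 0) (hqb : q b = 1) :
    ∀ i, 0 ≤ q i ∧ q i ≤ 1 := by
  have hh : ∀ i, i ≠ a → i ≠ b → ∑ j, G i j * q j = q i := by
    intro i hia hib
    have := congrFun hq i
    simpa only [Matrix.mulVec, dotProduct, hother i hia hib] using this
  intro i
  constructor
  · have := max_principle_aux G hnonneg hrowsum hirr a b (fun i => - q i) 0
      (by simp [hqa]) (by simp [hqb])
      (by intro i hia hib; simp [hh i hia hib]) i
    linarith
  · exact max_principle_aux G hnonneg hrowsum hirr a b q 1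
      (by simp [hqa]) (by simp [hqb]) hh i
end
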